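/- Let k be a finite field, R a split local Frobenius k-algebra, Q = (I, E, s, t) a finite quiver, and α : I → ℕ a rank vector such that k contains a primitive |α|-th root of unity, where |α| = Σ_{i∈I} α(i). Let Q' = (I, E, s', t') be obtained from Q by changing the orientation of some arrows, i.e. for each a ∈ E either (s'(a), t'(a)) = (s(a), t(a)) or (s'(a), t'(a)) = (t(a), s(a)). Then a_α(RQ) = a_α(RQ'): the number of G_α(R)-orbits of absolutely indecomposable representations in Rep^α(Q,R) equals the number of G_α(R)-orbits of absolutely indecomposable representations in Rep^α(Q',R). -/

import Mathlib

open Matrix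

/-- The space of locally free representations of rank `α` of the quiver with vertex set `I`,
arrow set `E`, source map `s` and target map `t`, over the commutative ring `S`. -/
abbrev QRep (I E : Type) (s t : E → I) (α : I → ℕ) (S : Type) [CommRing S] : Type :=
  ∀ a : E, Matrix (Fin (α (t a))) (Fin (α (s a))) S

/-- The group `G_α(S) = ∏_i GL_{α i}(S)`. -/
abbrev QGl (I : Type) (α : I → ℕ) (S : Type) [CommRing S] : Type :=
  ∀ i : I, (Matrix (Fin (α i)) (Fin (α i)) S)ˣ

/-- The action of `G_α(S)` on representations: `(g • M)_a = g_{t a} * M_a * g_{s a}⁻¹`. -/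
def QAct {I E : Type} (s t : E → I) (α : I → ℕ) {S : Type} [CommRing S]
    (g : QGl I α S) (M : QRep I E s t α S) : QRep I E s t α S :=
  fun a => (g (t a)).val * M a * (g (s a)).inv

/-- A representation is decomposable if, after acting by some `g ∈ G_α(S)`, it is
simultaneously block-diagonal with respect to a nontrivial splitting `α = β + γ`. -/
def QDecomposable {I E : Type} (s t : E → I) (α : I → ℕ) (S : Type) [CommRing S]
    (M : QRep I E s t α S) : Prop :=
  ∃ β γ : I → ℕ, (∀ i, β i + γ i = α i) ∧ β ≠ 0 ∧ γ ≠ 0 ∧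
    ∃ g : QGl I α S, ∀ (a : E) (r : Fin (α (t a))) (c : Fin (α (s a))),
      (((r : ℕ) < β (t a) ∧ β (s a) ≤ (c : ℕ)) ∨ (β (t a) ≤ (r : ℕ) ∧ (c : ℕ) < β (s a))) →
      QAct s t α g M a r c = 0

/-- A representation over the `k`-algebra `R` is absolutely indecomposable if its entrywise
base change to `R ⊗_k k̄`, for `k̄` an algebraic closure of `k`, is indecomposable. -/
def QAbsInd (k : Type) [Field k] {I E : Type} (s t : E → I) (α : I → ℕ)
    (R : Type) [CommRing R] [Algebra k R] (M : QRep I E s t α R) : Prop :=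
  ¬ QDecomposable s t α (TensorProduct k R (AlgebraicClosure k))
      (fun a => (M a).map ⇑(algebraMap R (TensorProduct k R (AlgebraicClosure k))))

/-- `a_α(RQ)`: the number of `G_α(R)`-orbits of absolutely indecomposable representations. -/
noncomputable def aOrbits (k : Type) [Field k] (I E : Type) (s t : E → I) (α : I → ℕ)
    (R : Type) [CommRing R] [Algebra k R] : ℕ :=
  Nat.card {O : Set (QRep I E s t α R) //
    ∃ M : QRep I E s t α R, QAbsInd k s t α R M ∧
      O = {N | ∃ g : QGl I α R, N = QAct s t α g M}}

open Polynomial in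
/-- In a `K`-algebra whose only idempotents are `0` and `1`, an algebraic element is nilpotent
or a unit. -/
theorem isNilpotent_or_isUnit_of_idempotents {K B : Type*} [Field K] [Ring B] [Algebra K B]
    (hB : ∀ e : B, IsIdempotentElem e → e = 0 ∨ e = 1) {x : B} (hx : IsAlgebraic K x) :
    IsNilpotent x ∨ IsUnit x := by
  obtain ⟨p, hp, hpx⟩ := hx
  obtain ⟨q, hpq, hq⟩ := exists_eq_pow_rootMultiplicity_mul_and_not_dvd p hp 0
  set a := p.rootMultiplicity 0
  rw [C_0, sub_zero] at hpq hq
  have hcop : IsCoprime (X ^ (a + 1)) q :=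
    IsCoprime.pow_left ((Irreducible.coprime_iff_not_dvd irreducible_X).2 hq)
  obtain ⟨u, v, huv⟩ := hcop
  have hz : aeval x (X ^ (a + 1) * q) = 0 := by
    rw [pow_succ', mul_assoc, ← hpq, map_mul, hpx, mul_zero]
  have h1 : aeval x (u * X ^ (a + 1)) + aeval x (v * q) = 1 := by
    rw [← map_add, huv, map_one]
  have hmul : aeval x (u * X ^ (a + 1)) * aeval x (v * q) = 0 := by
    rw [← map_mul, show u * X ^ (a + 1) * (v * q) = u * v * (X ^ (a + 1) * q) by ring,
      map_mul, hz, mul_zero]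
  have hid : IsIdempotentElem (aeval x (v * q)) := by
    have := congrArg (· * aeval x (v * q)) h1
    simp only [add_mul, hmul, zero_add, one_mul] at this
    exact this
  rcases hB _ hid with h0 | h0
  · right
    rw [h0, add_zero] at h1
    refine ⟨⟨x, aeval x (u * X ^ a), ?_, ?_⟩, rfl⟩
    · rw [← h1, show u * X ^ (a + 1) = X * (u * X ^ a) by ring, map_mul (aeval x) X, aeval_X]
    · rw [← h1, show u * X ^ (a + 1) = u * X ^ a * X by ring, map_mul (aeval x) (u * X ^ a) X,
        aeval_X]
  · left
    refine ⟨a + 1, ?_⟩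
    have : aeval x ((X : K[X]) ^ (a + 1)) * aeval x (v * q) = 0 := by
      rw [← map_mul, show (X : K[X]) ^ (a + 1) * (v * q) = v * (X ^ (a + 1) * q) by ring,
        map_mul, hz, mul_zero]
    simpa [h0] using this

/-- An idempotent matrix over a local ring is conjugate to a diagonal matrix with entries `1`
followed by `0`. -/
theorem Matrix.exists_conj_eq_diagonal_of_isIdempotentElem {S : Type*} [CommRing S]
    [IsLocalRing S] {n : ℕ} (e : Matrix (Fin n) (Fin n) S) (he : IsIdempotentElem e) :
    ∃ b ≤ n, ∃ P : (Matrix (Fin n) (Fin n) S)ˣ,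
      P.val * e = diagonal (fun i : Fin n => if (i : ℕ) < b then (1 : S) else 0) * P.val := by
  set f := toLin' e
  have hf : IsIdempotentElem f := by
    rw [IsIdempotentElem, Module.End.mul_eq_comp, ← toLin'_mul, he.eq]
  have hff (v) : f (f v) = f v := congrArg (fun g : Module.End S _ => g v) hf.eq
  have hcompl := LinearMap.IsIdempotentElem.isCompl hf
  have : Module.Projective S (LinearMap.range f) :=
    Module.Projective.of_split (LinearMap.range f).subtype f.rangeRestrict (by
      ext ⟨_, v, rfl⟩ : 1
      exact Subtype.ext (hff v))
  have hk (v) : v - f v ∈ LinearMap.ker f := by simp [hff]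
  have : Module.Projective S (LinearMap.ker f) :=
    Module.Projective.of_split (LinearMap.ker f).subtype
      ((LinearMap.id - f).codRestrict (LinearMap.ker f) hk) (by
      ext ⟨v, hv⟩ : 1
      refine Subtype.ext ?_
      simp [LinearMap.mem_ker.1 hv])
  have : Module.Finite S (LinearMap.ker f) :=
    Module.Finite.of_surjective ((LinearMap.id - f).codRestrict (LinearMap.ker f) hk) (by
      rintro ⟨v, hv⟩
      exact ⟨v, Subtype.ext (by simp [LinearMap.mem_ker.1 hv])⟩)
  have : Module.Free S (LinearMap.range f) := Module.free_of_flat_of_isLocalRing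
  have : Module.Free S (LinearMap.ker f) := Module.free_of_flat_of_isLocalRing
  let b₁ := Module.finBasis S (LinearMap.ker f)
  let b₂ := Module.finBasis S (LinearMap.range f)
  set r := Module.finrank S (LinearMap.range f)
  let b := (b₂.prod b₁).map (Submodule.prodEquivOfIsCompl _ _ hcompl)
  have hrs : r + Module.finrank S (LinearMap.ker f) = n := by
    simpa using Module.finrank_eq_card_basis b |>.symm
  let σ := finSumFinEquiv.trans (finCongr hrs)
  let c := b.reindex σ
  have hc (i : Fin n) : f (c i) = if (i : ℕ) < r then c i else 0 := by
    obtain ⟨j | j, rfl⟩ := σ.surjective i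
    · have : ((σ (Sum.inl j) : Fin n) : ℕ) < r := by simp [σ]
      rw [if_pos this]
      obtain ⟨v, hv⟩ := (b₂ j).2
      simp [c, b, ← hv, hff]
    · have : ¬ ((σ (Sum.inr j) : Fin n) : ℕ) < r := by simp [σ]
      rw [if_neg this]
      simp [c, b]
  let w := Pi.basisFun S (Fin n)
  let P : (Matrix (Fin n) (Fin n) S)ˣ :=
    ⟨c.toMatrix w, w.toMatrix c, c.toMatrix_mul_toMatrix_flip w, w.toMatrix_mul_toMatrix_flip c⟩
  refine ⟨r, by omega, P, ?_⟩
  have key : e * (P⁻¹).val =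
      (P⁻¹).val * diagonal (fun i : Fin n => if (i : ℕ) < r then (1 : S) else 0) := by
    ext i j
    have := congrFun (hc j) i
    rw [mul_diagonal]
    change (e *ᵥ (c j)) i = c j i * _
    rw [← toLin'_apply, this]
    split_ifs <;> simp
  calc P.val * e = P.val * (e * (P⁻¹).val) * P.val := by simp [mul_assoc]
    _ = _ := by rw [key]; simp

theorem Matrix.det_algebraMap_add_of_isNilpotent {K ι : Type*} [Field K] [Fintype ι]
    [DecidableEq ι] {N : Matrix ι ι K} (hN : IsNilpotent N) (c : K) :
    (algebraMap K (Matrix ι ι K) c + N).det = c ^ Fintype.card ι := by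
  have h := (isNilpotent_charpoly_sub_pow_of_isNilpotent hN.neg).eq_zero
  have h2 := eval_charpoly (-N) c
  rw [sub_eq_zero.1 h] at h2
  simp only [Polynomial.eval_pow, Polynomial.eval_X, sub_neg_eq_add] at h2
  exact h2.symm

open Polynomial in
/-- A root of the characteristic polynomial of `M`, in an extension field. -/
theorem Matrix.aeval_charpoly_eq_zero_iff {K L ι : Type*} [Field K] [Field L] [Algebra K L]
    [Fintype ι] [DecidableEq ι] (M : Matrix ι ι K) (r : L) :
    aeval r M.charpoly = 0 ↔ r ∈ spectrum L ((algebraMap K L).mapMatrix M) := by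
  rw [mem_spectrum_iff_isRoot_charpoly, RingHom.mapMatrix_apply, charpoly_map, IsRoot,
    eval_map_algebraMap]

open Polynomial in
theorem Matrix.aeval_charpoly_aeval_eq_zero {K L ι : Type*} [Field K] [Field L] [Algebra K L]
    [Fintype ι] [DecidableEq ι] {M : Matrix ι ι K} {r : L} (hr : aeval r M.charpoly = 0)
    (h : K[X]) : aeval (aeval r h) (aeval M h).charpoly = 0 := by
  rw [aeval_charpoly_eq_zero_iff] at hr ⊢
  have h1 := spectrum.subset_polynomial_aeval ((algebraMap K L).mapMatrix M)
    (h.map (algebraMap K L)) ⟨r, hr, rfl⟩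
  have h2 : (algebraMap K L).mapMatrix (aeval M h) =
      aeval ((algebraMap K L).mapMatrix M) (h.map (algebraMap K L)) := by
    rw [aeval_map_algebraMap]
    exact (aeval_algHom_apply ((Algebra.ofId K L).mapMatrix) M h).symm
  rw [h2]
  simpa [eval_map_algebraMap] using h1

theorem MulChar.pow_eq_one_of_forall {k C : Type*} [Field k] [CommRing C] {θ : MulChar k C} {m : ℕ}
    (h : ∀ c : kˣ, θ c ^ m = 1) : θ ^ m = 1 := by
  ext c
  rw [MulChar.pow_apply_coe, h c, MulChar.one_apply_coe]

section CharacterTrivialOnUnits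

variable {k A ι T : Type*} [Field k] [Ring A] [Algebra k A]
  [Fintype ι] [DecidableEq ι] [CommRing T] {Φ : A →ₐ[k] Matrix ι ι k}
  {θ : MulChar k T}

theorem eq_zero_or_one_of_mulChar_det_eq_one (hΦ : ∀ x, IsNilpotent (Φ x) → IsNilpotent x)
    (hθ : orderOf θ = Fintype.card ι) (h : ∀ g : A, IsUnit g → θ (Φ g).det = 1)
    (e : A) (he : IsIdempotentElem e) : e = 0 ∨ e = 1 := by
  set n := Fintype.card ι
  let ρ := reindexAlgEquiv k k (Fintype.equivFin ι)
  obtain ⟨b, hbn, P, hP⟩ := exists_conj_eq_diagonal_of_isIdempotentElem (ρ (Φ e))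
    ((he.map Φ).map ρ)
  set D : Matrix (Fin n) (Fin n) k := diagonal fun i : Fin n => if (i : ℕ) < b then (1 : k) else 0
    with hD
  have hdet (c : kˣ) : θ c ^ b = 1 := by
    let g : A := (c : k) • e + (1 - e)
    have hg : IsUnit g := by
      have hmul (c d : k) (hcd : c * d = 1) : (c • e + (1 - e)) * (d • e + (1 - e)) = 1 := by
        have h1 : e * (1 - e) = 0 := he.mul_one_sub_self
        have h2 : (1 - e) * e = 0 := he.one_sub_mul_self
        rw [add_mul, mul_add, mul_add, smul_mul_smul_comm, he.eq, hcd, smul_mul_assoc, h1,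
          mul_smul_comm, h2, he.one_sub.eq]
        simp
      exact ⟨⟨g, _, hmul c (c⁻¹ : kˣ) (by simp), hmul (c⁻¹ : kˣ) c (by simp)⟩, rfl⟩
    have h1 : P.val * ρ (Φ g) = ((c : k) • D + (1 - D)) * P.val := by
      simp only [g, map_add, map_smul, map_sub, map_one, mul_add, mul_smul_comm, hP, mul_sub,
        mul_one, add_mul, sub_mul, one_mul, smul_mul_assoc]
    have h2 := congrArg det h1
    have hPu : P.val.det ≠ 0 := (P.isUnit.map detMonoidHom).ne_zero
    rw [det_mul, det_mul, mul_comm] at h2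
    have h3 := mul_right_cancel₀ hPu h2
    have h4 : (ρ (Φ g)).det = (Φ g).det := det_reindex_self (Fintype.equivFin ι) (Φ g)
    have h5 : (c : k) • D + (1 - D) =
        diagonal fun i : Fin n => if (i : ℕ) < b then (c : k) else 1 := by
      ext i j
      by_cases hij : i = j
      · subst hij
        by_cases hi : (i : ℕ) < b <;> simp [hD, hi]
      · simp [hD, hij]
    rw [h4, h5, det_diagonal, Finset.prod_ite, Finset.prod_const, Finset.prod_const_one, mul_one,
      Fin.card_filter_val_lt, min_eq_right hbn] at h3
    rw [← map_pow, ← h3]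
    exact h g hg
  have hdvd : n ∣ b := hθ ▸ orderOf_dvd_of_pow_eq_one (MulChar.pow_eq_one_of_forall hdet)
  rcases Nat.eq_zero_or_pos b with rfl | hb
  · left
    have hD0 : D = 0 := by simp [hD]
    rw [hD0, zero_mul, Units.mul_right_eq_zero, EmbeddingLike.map_eq_zero_iff] at hP
    exact he.eq_zero_of_isNilpotent (hΦ e (hP ▸ IsNilpotent.zero))
  · right
    have hbn' : b = n := le_antisymm hbn (Nat.le_of_dvd hb hdvd)
    have hD1 : D = 1 := by
      rw [hD, ← diagonal_one]
      congr 1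
      ext i
      rw [if_pos (hbn' ▸ i.2)]
    rw [hD1, one_mul, ← sub_eq_zero, ← mul_sub_one, Units.mul_right_eq_zero, sub_eq_zero,
      EmbeddingLike.map_eq_one_iff] at hP
    have : IsNilpotent (1 - e) := hΦ _ (by simp [hP])
    exact (sub_eq_zero.1 (he.one_sub.eq_zero_of_isNilpotent this)).symm

variable {L : Type*} [Field L] [Algebra k L]

open Polynomial

theorem Matrix.IsNilpotent.root_charpoly_eq_zero {M : Matrix ι ι k} (hM : IsNilpotent M) {r : L}
    (hr : aeval r M.charpoly = 0) : r = 0 := by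
  rw [sub_eq_zero.1 (isNilpotent_charpoly_sub_pow_of_isNilpotent hM).eq_zero] at hr
  simpa using eq_zero_of_pow_eq_zero (by simpa using hr)

theorem Matrix.IsUnit.root_charpoly_ne_zero {M : Matrix ι ι k} (hM : IsUnit M) {r : L}
    (hr : aeval r M.charpoly = 0) : r ≠ 0 := by
  rintro rfl
  rw [aeval_charpoly_eq_zero_iff, spectrum.zero_mem_iff] at hr
  exact hr (hM.map _)

theorem Polynomial.eq_pow_minpoly {k L : Type*} [Field k] [Field L] [Algebra k L] {w : L}
    (hw : IsIntegral k w) {p : k[X]} (hp : p.Monic)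
    (h : ∀ s : AlgebraicClosure k, aeval s p = 0 → aeval s (minpoly k w) = 0) :
    ∃ m, p = minpoly k w ^ m := by
  classical
  have hall : ∀ g ∈ UniqueFactorizationMonoid.normalizedFactors p, g = minpoly k w := by
    intro g hg
    have hirr := UniqueFactorizationMonoid.irreducible_of_normalized_factor g hg
    have hmon : g.Monic := by
      have := UniqueFactorizationMonoid.normalize_normalized_factor g hg
      rw [← this]
      exact monic_normalize hirr.ne_zero
    obtain ⟨s, hs⟩ := IsAlgClosed.exists_aeval_eq_zero (AlgebraicClosure k) g
      (degree_pos_of_irreducible hirr).ne'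
    have hsp : aeval s p = 0 :=
      aeval_eq_zero_of_dvd_aeval_eq_zero
        (UniqueFactorizationMonoid.dvd_of_mem_normalizedFactors hg) hs
    rw [minpoly.eq_of_irreducible_of_monic hirr hs hmon,
      minpoly.eq_of_irreducible_of_monic (minpoly.irreducible hw) (h s hsp) (minpoly.monic hw)]
  have hprod := UniqueFactorizationMonoid.prod_normalizedFactors_eq hp.ne_zero
  rw [Multiset.eq_replicate_of_mem hall, Multiset.prod_replicate, hp.normalize_eq_self] at hprod
  exact ⟨_, hprod.symm⟩

theorem exists_isNilpotent_sub_of_mulChar_det_eq_one [Fintype k] [Module.Finite k A]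
    (hΦ : ∀ x, IsNilpotent (Φ x) → IsNilpotent x)
    (hθ : orderOf θ = Fintype.card ι) (hι : 0 < Fintype.card ι)
    (h : ∀ g : A, IsUnit g → θ (Φ g).det = 1) (x : A) :
    ∃ c : k, IsNilpotent (x - algebraMap k A c) := by
  have hA (y : A) : IsNilpotent y ∨ IsUnit y :=
    isNilpotent_or_isUnit_of_idempotents (eq_zero_or_one_of_mulChar_det_eq_one hΦ hθ h)
      (IsIntegral.of_finite k y).isAlgebraic
  have hnil (y : A) {L : Type _} [Field L] [Algebra k L]
      (hy : aeval (0 : L) (Φ y).charpoly = 0) : IsNilpotent y :=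
    (hA y).resolve_right fun hu => Matrix.IsUnit.root_charpoly_ne_zero (hu.map Φ) hy rfl
  obtain ⟨r₀, hr₀⟩ := IsAlgClosed.exists_aeval_eq_zero (AlgebraicClosure k) (Φ x).charpoly (by
    rw [charpoly_degree_eq_dim]
    exact_mod_cast hι.ne')
  have hr₀i : IsIntegral k r₀ := Algebra.IsIntegral.isIntegral r₀
  let K := IntermediateField.adjoin k {r₀}
  have : FiniteDimensional k K := IntermediateField.adjoin.finiteDimensional hr₀i
  have : Finite K := Module.finite_of_finite k
  let r : K := IntermediateField.AdjoinSimple.gen k r₀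
  have hr : aeval r (Φ x).charpoly = 0 := by
    apply (algebraMap K (AlgebraicClosure k)).injective
    rw [← aeval_algebraMap_apply, map_zero]
    exact hr₀
  suffices hrk : ∃ c : k, algebraMap k K c = r by
    obtain ⟨c, hc⟩ := hrk
    refine ⟨c, hnil (L := K) _ ?_⟩
    have := aeval_charpoly_aeval_eq_zero hr (X - C c)
    rw [← hc] at this
    simpa [Polynomial.aeval_algHom_apply] using this
  obtain ⟨u, hu⟩ := IsCyclic.exists_generator (α := Kˣ)
  obtain ⟨p, hp⟩ := (IntermediateField.adjoin.powerBasis hr₀i).exists_eq_aeval' (u : K)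
  rw [IntermediateField.adjoin.powerBasis_gen] at hp
  set w : K := u.val
  have hwi : IsIntegral k w := IsIntegral.of_finite k w
  let y := aeval x p
  have hΦa (q : k[X]) (z : A) : Φ (aeval z q) = aeval (Φ z) q := (aeval_algHom_apply Φ z q).symm
  have hw : aeval w (Φ y).charpoly = 0 := by
    rw [hΦa, hp]
    exact aeval_charpoly_aeval_eq_zero hr p
  have hy : IsUnit y := (hA y).resolve_left fun hn =>
    u.ne_zero (Matrix.IsNilpotent.root_charpoly_eq_zero (hn.map Φ) hw)
  have hfy : IsNilpotent (aeval y (minpoly k w)) := by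
    refine hnil (L := K) _ ?_
    have := aeval_charpoly_aeval_eq_zero hw (minpoly k w)
    rwa [minpoly.aeval, ← hΦa] at this
  obtain ⟨m, hm⟩ := Polynomial.eq_pow_minpoly hwi (charpoly_monic (Φ y)) (fun s hs =>
    Matrix.IsNilpotent.root_charpoly_eq_zero (hfy.map Φ) (by
      rw [hΦa]
      exact aeval_charpoly_aeval_eq_zero hs _))
  set d := (minpoly k w).natDegree
  have hn : Fintype.card ι = m * d := by
    rw [← charpoly_natDegree_eq_dim (Φ y), hm, natDegree_pow]
  set v : k := (-1) ^ d * (minpoly k w).coeff 0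
  have hdet : (Φ y).det = v ^ m := by
    rw [det_eq_sign_charpoly_coeff, hm, hn, coeff_zero_eq_eval_zero, eval_pow,
      ← coeff_zero_eq_eval_zero, mul_pow, ← pow_mul, mul_comm m d]
  have hnorm : ∃ e, Algebra.norm k w = v ^ e := by
    refine ⟨Module.finrank (IntermediateField.adjoin k {w}) K, ?_⟩
    rw [Algebra.norm_eq_norm_adjoin k w, ← IntermediateField.adjoin.powerBasis_gen hwi,
      Algebra.PowerBasis.norm_gen_eq_coeff_zero_minpoly, IntermediateField.adjoin.powerBasis_gen,
      IntermediateField.minpoly_gen, IntermediateField.adjoin.powerBasis_dim]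
  obtain ⟨e, he⟩ := hnorm
  have hθm : θ ^ m = 1 := by
    refine MulChar.pow_eq_one_of_forall fun c => ?_
    obtain ⟨z, hz⟩ := FiniteField.unitsMap_norm_surjective k K c
    obtain ⟨j, hj⟩ := (mem_powers_iff_mem_zpowers (x := u) (y := z)).2 (hu z)
    have hc : (c : k) = v ^ (e * j) := by
      rw [← hz, ← hj]
      simp [pow_mul, ← he, w]
    rw [hc, map_pow, ← pow_mul, mul_comm, pow_mul, ← map_pow, ← hdet, h y hy, one_pow]
  have hdvd : m * d ∣ m := hn ▸ hθ ▸ orderOf_dvd_of_pow_eq_one hθm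
  have hd : d = 1 := by
    have hm0 : 0 < m := Nat.pos_of_ne_zero fun h0 => by simp [h0] at hn; omega
    exact Nat.dvd_one.1 (Nat.dvd_of_mul_dvd_mul_left hm0 (by simpa using hdvd))
  obtain ⟨c, hc⟩ := minpoly.natDegree_eq_one_iff.1 hd
  by_cases hr0 : r = 0
  · exact ⟨0, by simp [hr0]⟩
  · obtain ⟨j, hj⟩ := (mem_powers_iff_mem_zpowers (x := u) (y := Units.mk0 r hr0)).2 (hu _)
    refine ⟨c ^ j, ?_⟩
    rw [map_pow, hc]
    exact congrArg Units.val hj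

end CharacterTrivialOnUnits

open Polynomial in
theorem FiniteField.mem_range_algebraMap_of_pow_card_eq {k K : Type*} [Field k] [Fintype k]
    [Field K] [Algebra k K] {r : K} (hr : r ^ Fintype.card k = r) :
    ∃ c : k, algebraMap k K c = r := by
  have hcard : 1 < Fintype.card k := Fintype.one_lt_card
  have h0 : aeval r (X ^ Fintype.card k - X : k[X]) = 0 := by simp [hr]
  have hsp := (splits_iff_card_roots (f := (X ^ Fintype.card k - X : k[X]))).2 (by
    rw [FiniteField.roots_X_pow_card_sub_X, FiniteField.X_pow_card_sub_X_natDegree_eq k hcard]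
    rfl)
  exact hsp.mem_range_of_isRoot (FiniteField.X_pow_card_sub_X_ne_zero k hcard)
    (by rwa [IsRoot, eval_map_algebraMap])

section

variable {k K B ι : Type*} [Field k] [Field K] [Algebra k K] [Ring B] [Algebra K B]
  [Fintype ι] [DecidableEq ι]

open Polynomial in
theorem exists_det_eq_pow_card_of_idempotents [Fintype k] [IsAlgClosed K]
    (hB : ∀ e : B, IsIdempotentElem e → e = 0 ∨ e = 1) (Ψ : B →ₐ[K] Matrix ι ι K) {b : B}
    (hb : IsAlgebraic K b) {M : Matrix ι ι k} (hM : Ψ b = (algebraMap k K).mapMatrix M) :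
    ∃ c : k, M.det = c ^ Fintype.card ι := by
  rcases isEmpty_or_nonempty ι with hι | hι
  · exact ⟨1, by simp⟩
  obtain ⟨r, hr⟩ := IsAlgClosed.exists_aeval_eq_zero K M.charpoly (by
    rw [charpoly_degree_eq_dim]
    exact_mod_cast Fintype.card_ne_zero)
  have hcp (s : K) (hs : aeval s M.charpoly = 0) : aeval s (Ψ b).charpoly = 0 := by
    rw [hM, aeval_charpoly_eq_zero_iff]
    rwa [aeval_charpoly_eq_zero_iff] at hs
  have halg : IsAlgebraic K (b - algebraMap K B r) := by
    obtain ⟨p, hp, hpb⟩ := hb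
    refine ⟨p.comp (X + C r), ?_, by simp [aeval_comp, hpb]⟩
    intro h0
    apply hp
    have := congrArg (fun q => q.comp (X - C r)) h0
    simpa [comp_assoc] using this
  have hshift (s : K) (hs : aeval s M.charpoly = 0) :
      aeval (s - r) (Ψ (b - algebraMap K B r)).charpoly = 0 := by
    have := aeval_charpoly_aeval_eq_zero (hcp s hs) (X - C r)
    simpa using this
  have hnil : IsNilpotent (Ψ (b - algebraMap K B r)) := by
    refine ((isNilpotent_or_isUnit_of_idempotents hB halg).resolve_right fun hu => ?_).map Ψ
    exact Matrix.IsUnit.root_charpoly_ne_zero (hu.map Ψ) (hshift r hr) (sub_self r)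
  have hfrob : aeval (r ^ Fintype.card k) M.charpoly = 0 := by
    have := aeval_algHom_apply (FiniteField.frobeniusAlgHom k K) r M.charpoly
    simpa [hr] using this
  have hrk := sub_eq_zero.1 (Matrix.IsNilpotent.root_charpoly_eq_zero hnil (hshift _ hfrob))
  obtain ⟨c, hc⟩ := FiniteField.mem_range_algebraMap_of_pow_card_eq hrk
  refine ⟨c, (algebraMap k K).injective ?_⟩
  rw [map_pow, hc, RingHom.map_det, ← hM, ← det_algebraMap_add_of_isNilpotent hnil r]
  simp

open scoped Pointwise in
theorem eq_zero_or_one_of_span_range {A : Type*} [Ring A] [Algebra k A] [Module.Finite k A]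
    (hA : ∀ x : A, ∃ c : k, IsNilpotent (x - algebraMap k A c)) (j : A →+* B)
    (hj : ∀ c, j (algebraMap k A c) = algebraMap K B (algebraMap k K c))
    (hspan : ∀ b : B, b ∈ Submodule.span K (Set.range j)) (e : B) (he : IsIdempotentElem e) :
    e = 0 ∨ e = 1 := by
  rcases subsingleton_or_nontrivial A with hA0 | hA0
  · left
    have h1 : (1 : B) = 0 := by rw [← map_one j, Subsingleton.elim (1 : A) 0, map_zero]
    rw [← mul_one e, h1, mul_zero]
  have hdich (x : A) : IsNilpotent x ∨ IsUnit x := by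
    obtain ⟨c, hc⟩ := hA x
    rcases eq_or_ne c 0 with rfl | hc0
    · left
      simpa using hc
    · right
      have hcu : IsUnit (algebraMap k A c) := (IsUnit.mk0 c hc0).map _
      have := hc.isUnit_add_left_of_commute hcu (Algebra.commutes c _).symm
      simpa using this
  have hJ (x : A) (hx : IsNilpotent x) : x ∈ Ring.jacobson A := by
    rw [← Ideal.jacobson_bot, Ideal.mem_jacobson_iff]
    intro y
    have hyx : IsNilpotent (y * x) := by
      refine (hdich _).resolve_right fun hu => ?_
      obtain ⟨u, hu⟩ := hu
      obtain ⟨m, hm⟩ := hx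
      have hz : (((u⁻¹ : Aˣ) : A) * y) * x = 1 := by rw [mul_assoc, ← hu, Units.inv_mul]
      have hzm (m : ℕ) : (((u⁻¹ : Aˣ) : A) * y) ^ m * x ^ m = 1 := by
        induction m with
        | zero => simp
        | succ m ih =>
          rw [pow_succ, pow_succ', mul_assoc, ← mul_assoc _ x, hz, one_mul, ih]
      have := hzm m
      rw [hm, mul_zero] at this
      exact zero_ne_one this
    obtain ⟨u, hu⟩ := hyx.isUnit_one_add
    refine ⟨(u⁻¹ : Aˣ), ?_⟩
    have h1 : ((u⁻¹ : Aˣ) : A) * (1 + y * x) = 1 := by rw [← hu, Units.inv_mul]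
    rw [mul_add, mul_one, ← mul_assoc] at h1
    rw [Ideal.mem_bot, sub_eq_zero, add_comm, h1]
  have : IsArtinianRing A := IsArtinianRing.of_finite k A
  obtain ⟨N, hN⟩ := IsSemiprimaryRing.isNilpotent (R := A)
  let J : Set A := Ring.jacobson A
  have hJN : ∀ n, J ^ n ⊆ (Ring.jacobson A ^ n : Ideal A) := by
    intro n
    induction n with
    | zero => simp [Submodule.pow_zero]
    | succ n ih =>
      rw [pow_succ', Ideal.IsTwoSided.pow_succ]
      rintro _ ⟨a, ha, b, hb, rfl⟩
      exact Ideal.mul_mem_mul ha (ih hb)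
  let T : Submodule K B := Submodule.span K (j '' J)
  have hTN : T ^ N = ⊥ := by
    rw [Submodule.span_pow, ← Set.image_pow, Submodule.span_eq_bot]
    rintro _ ⟨x, hx, rfl⟩
    have := hJN N hx
    rw [hN] at this
    rw [show x = 0 from this, map_zero]
  have hdec (b : B) : ∃ c : K, b - algebraMap K B c ∈ T := by
    induction hspan b using Submodule.span_induction with
    | mem b hb =>
      obtain ⟨x, rfl⟩ := hb
      obtain ⟨c, hc⟩ := hA x
      refine ⟨algebraMap k K c, ?_⟩
      rw [← hj, ← map_sub]
      exact Submodule.subset_span ⟨_, hJ _ hc, rfl⟩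
    | zero => exact ⟨0, by simp⟩
    | add a b _ _ ha hb =>
      obtain ⟨c, hc⟩ := ha
      obtain ⟨d, hd⟩ := hb
      refine ⟨c + d, ?_⟩
      rw [map_add, add_sub_add_comm]
      exact T.add_mem hc hd
    | smul l b _ hb =>
      obtain ⟨c, hc⟩ := hb
      refine ⟨l * c, ?_⟩
      have := T.smul_mem l hc
      rwa [smul_sub, Algebra.smul_def l (algebraMap K B c), ← map_mul] at this
  obtain ⟨c, hc⟩ := hdec e
  have hnil : IsNilpotent (e - algebraMap K B c) := by
    refine ⟨N, ?_⟩
    have := Submodule.pow_mem_pow T hc N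
    rwa [hTN] at this
  rcases eq_or_ne c 0 with rfl | hc0
  · left
    rw [map_zero, sub_zero] at hnil
    exact he.eq_zero_of_isNilpotent hnil
  · right
    have hcu : IsUnit (algebraMap K B c) := (IsUnit.mk0 c hc0).map _
    have hu : IsUnit e := by
      simpa using hnil.isUnit_add_left_of_commute hcu (Algebra.commutes c _).symm
    exact hu.mul_left_cancel (he.eq.trans (mul_one e).symm)

end

section Decomposition

variable {I E : Type} {s t : E → I} {α : I → ℕ} {S : Type} [CommRing S]

theorem Matrix.diagonal_mul_eq_mul_diagonal_iff {m n b c : ℕ} [Nontrivial S]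
    (N : Matrix (Fin m) (Fin n) S) :
    diagonal (fun i : Fin m => if (i : ℕ) < b then (1 : S) else 0) * N =
        N * diagonal (fun i : Fin n => if (i : ℕ) < c then (1 : S) else 0) ↔
      ∀ (i : Fin m) (j : Fin n),
        (((i : ℕ) < b ∧ c ≤ (j : ℕ)) ∨ (b ≤ (i : ℕ) ∧ (j : ℕ) < c)) → N i j = 0 := by
  rw [← Matrix.ext_iff]
  refine forall_congr' fun i => forall_congr' fun j => ?_
  rw [diagonal_mul, mul_diagonal]
  by_cases hi : (i : ℕ) < b <;> by_cases hj : (j : ℕ) < c <;>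
    simp [hi, hj, not_lt.1, eq_comm, not_le.2]

theorem QDecomposable_iff_exists_isIdempotentElem [IsLocalRing S] (M : QRep I E s t α S) :
    QDecomposable s t α S M ↔ ∃ e : ∀ i, Matrix (Fin (α i)) (Fin (α i)) S,
      IsIdempotentElem e ∧ e ≠ 0 ∧ e ≠ 1 ∧ ∀ a, e (t a) * M a = M a * e (s a) := by
  constructor
  · rintro ⟨β, γ, hβγ, hβ, hγ, g, hg⟩
    let D (i : I) : Matrix (Fin (α i)) (Fin (α i)) S :=
      diagonal fun r => if (r : ℕ) < β i then (1 : S) else 0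
    have hDD (i) : D i * D i = D i := by simp [D, diagonal_mul_diagonal]
    let e : ∀ i, Matrix (Fin (α i)) (Fin (α i)) S := fun i =>
      ((g i)⁻¹).val * D i * (g i).val
    have hDe (i) : D i = (g i).val * e i * ((g i)⁻¹).val := by simp [e, mul_assoc]
    refine ⟨e, ?_, ?_, ?_, fun a => ?_⟩
    · ext1 i
      have : e i * e i = ((g i)⁻¹).val * (D i * D i) * (g i).val := by simp [e, mul_assoc]
      rw [Pi.mul_apply, this, hDD]
    · intro h0
      obtain ⟨i, hi⟩ := Function.ne_iff.1 hβ
      have h1 : D i = 0 := by rw [hDe, h0]; simp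
      have hi' : 0 < β i := Nat.pos_of_ne_zero hi
      have := congrFun (congrFun h1 ⟨0, by have := hβγ i; omega⟩) ⟨0, by have := hβγ i; omega⟩
      simp [D, hi'] at this
    · intro h0
      obtain ⟨i, hi⟩ := Function.ne_iff.1 hγ
      have h1 : D i = 1 := by rw [hDe, h0]; simp
      have hi' : 0 < γ i := Nat.pos_of_ne_zero hi
      have := congrFun (congrFun h1 ⟨β i, by have := hβγ i; omega⟩)
        ⟨β i, by have := hβγ i; omega⟩
      simp [D] at this
    · have h := (diagonal_mul_eq_mul_diagonal_iff _).2 (hg a)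
      change D (t a) * _ = _ * D (s a) at h
      simp only [QAct, Units.inv_eq_val_inv] at h
      have h2 := congrArg (fun Z => ((g (t a))⁻¹).val * Z * (g (s a)).val) h
      simp only [hDe, Matrix.mul_assoc, Units.inv_mul, Matrix.mul_one] at h2
      simpa [← Matrix.mul_assoc] using h2
  · rintro ⟨e, he, h0, h1, hM⟩
    choose b hb P hP using fun i =>
      exists_conj_eq_diagonal_of_isIdempotentElem (e i) (congrFun he.eq i)
    refine ⟨b, fun i => α i - b i, fun i => Nat.add_sub_of_le (hb i), ?_, ?_, P, fun a => ?_⟩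
    · rintro rfl
      apply h0
      ext1 i
      have := hP i
      simpa using this
    · intro hγ
      apply h1
      ext1 i
      have hbi : b i = α i := by have := congrFun hγ i; have := hb i; simp at *; omega
      have hD : (diagonal fun r : Fin (α i) => if (r : ℕ) < b i then (1 : S) else 0) = 1 := by
        rw [← diagonal_one]
        congr 1
        ext r
        rw [if_pos (by have := r.2; omega)]
      have := hP i
      rw [hD, one_mul] at this
      have h2 := congrArg (fun Z => ((P i)⁻¹).val * Z) this
      simpa using h2
    · apply (diagonal_mul_eq_mul_diagonal_iff _).1
      simp only [QAct, Units.inv_eq_val_inv]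
      rw [← Matrix.mul_assoc, ← Matrix.mul_assoc, ← hP, Matrix.mul_assoc _ (e _), hM]
      have h2 : e (s a) * ((P (s a))⁻¹).val = ((P (s a))⁻¹).val *
          diagonal fun r : Fin (α (s a)) => if (r : ℕ) < b (s a) then (1 : S) else 0 := by
        have := congrArg (fun Z => ((P (s a))⁻¹).val * Z * ((P (s a))⁻¹).val) (hP (s a))
        simpa [← mul_assoc, mul_assoc _ (P (s a)).val] using this
      simp only [Matrix.mul_assoc, h2]

end Decomposition

section Endomorphisms

open Polynomial in
theorem Matrix.isNilpotent_of_isNilpotent_map {S K n : Type*} [CommRing S] [Field K] [Fintype n]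
    [DecidableEq n] (φ : S →+* K) (hφ : ∀ r, φ r = 0 → IsNilpotent r) {X : Matrix n n S}
    (hX : IsNilpotent (X.map φ)) : IsNilpotent X := by
  have h1 := sub_eq_zero.1 (isNilpotent_charpoly_sub_pow_of_isNilpotent hX).eq_zero
  rw [charpoly_map] at h1
  have h2 : IsNilpotent (X.charpoly - Polynomial.X ^ Fintype.card n) := by
    rw [Polynomial.isNilpotent_iff]
    intro i
    apply hφ
    rw [← coeff_map, Polynomial.map_sub, h1]
    simp
  have h3 := (h2.map (aeval X)).neg
  rw [map_sub, aeval_self_charpoly] at h3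
  simp only [map_pow, aeval_X, zero_sub, neg_neg] at h3
  obtain ⟨m, hm⟩ := h3
  exact ⟨Fintype.card n * m, by rw [pow_mul, hm]⟩

variable {I E : Type} {s t : E → I} {α : I → ℕ} {S : Type} [CommRing S]
  {K : Type} [Field K] [Algebra K S]

/-- The endomorphism algebra of a locally free representation. -/
def QEnd (K : Type) [Field K] [Algebra K S] (M : QRep I E s t α S) :
    Subalgebra K (∀ i, Matrix (Fin (α i)) (Fin (α i)) S) where
  carrier := {X | ∀ a, X (t a) * M a = M a * X (s a)}
  mul_mem' {X Y} hX hY a := by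
    rw [Pi.mul_apply, Pi.mul_apply, Matrix.mul_assoc, hY a, ← Matrix.mul_assoc, hX a,
      Matrix.mul_assoc]
  add_mem' {X Y} hX hY a := by
    rw [Pi.add_apply, Pi.add_apply, Matrix.add_mul, hX a, hY a, Matrix.mul_add]
  algebraMap_mem' c a := by
    simp [Pi.algebraMap_apply, Algebra.algebraMap_eq_smul_one]

theorem QAct_eq_self_iff (M : QRep I E s t α S) (g : QGl I α S) :
    QAct s t α g M = M ↔ ∀ a, (g (t a)).val * M a = M a * (g (s a)).val := by
  refine funext_iff.trans (forall_congr' fun a => ?_)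
  rw [QAct, Units.inv_eq_val_inv]
  constructor
  · intro h
    have := congrArg (· * (g (s a)).val) h
    simpa [Matrix.mul_assoc] using this
  · intro h
    rw [h]
    simp [Matrix.mul_assoc]

variable [Fintype I] [DecidableEq I]

/-- Reduction of a tuple of matrices along `φ : S → K`, as a block diagonal matrix. -/
def blockReduction (α : I → ℕ) (φ : S →ₐ[K] K) :
    (∀ i, Matrix (Fin (α i)) (Fin (α i)) S) →ₐ[K]
      Matrix (Σ i, Fin (α i)) (Σ i, Fin (α i)) K where
  toRingHom := (blockDiagonal'RingHom (fun i => Fin (α i)) K).comp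
    (RingHom.pi fun i => (φ : S →+* K).mapMatrix.comp (Pi.evalRingHom _ i))
  commutes' c := by
    change blockDiagonal' (fun i => (algebraMap K (Matrix (Fin (α i)) (Fin (α i)) S) c).map φ) = _
    ext ⟨i, x⟩ ⟨j, y⟩
    by_cases hij : i = j
    · subst hij
      by_cases hxy : x = y <;> simp [algebraMap_matrix_apply, hxy]
    · simp [algebraMap_matrix_apply, blockDiagonal'_apply, hij]

theorem blockReduction_apply (φ : S →ₐ[K] K) (X : ∀ i, Matrix (Fin (α i)) (Fin (α i)) S) :
    blockReduction α φ X = blockDiagonal' fun i => (X i).map φ := rfl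

theorem isNilpotent_of_isNilpotent_blockReduction (φ : S →ₐ[K] K)
    (hφ : ∀ r, φ r = 0 → IsNilpotent r) (X : ∀ i, Matrix (Fin (α i)) (Fin (α i)) S)
    (h : IsNilpotent (blockReduction α φ X)) : IsNilpotent X := by
  obtain ⟨N, hN⟩ := h
  have h1 (i : I) : IsNilpotent (X i) := by
    refine isNilpotent_of_isNilpotent_map (φ : S →+* K) hφ ⟨N, ?_⟩
    rw [← map_pow, blockReduction_apply] at hN
    have := congrFun (blockDiagonal'_injective (hN.trans blockDiagonal'_zero.symm)) i
    rw [Pi.pow_apply] at this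
    exact (map_pow ((φ : S →+* K).mapMatrix) (X i) N).symm.trans this
  choose m hm using h1
  refine ⟨∑ i, m i, ?_⟩
  ext1 i
  exact pow_eq_zero_of_le (Finset.single_le_sum (fun _ _ => Nat.zero_le _) (Finset.mem_univ i))
    (hm i)

end Endomorphisms

section Characterization

variable {I E : Type} {s t : E → I} {α : I → ℕ} {k R K S : Type} [Field k] [CommRing R]
  [Algebra k R] [Field K] [CommRing S] [Algebra K S] [Algebra R S]

/-- Entrywise application of a ring homomorphism to a tuple of matrices. -/
def tupleMap (α : I → ℕ) {R S : Type} [CommRing R] [CommRing S] (f : R →+* S) :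
    (∀ i, Matrix (Fin (α i)) (Fin (α i)) R) →+* ∀ i, Matrix (Fin (α i)) (Fin (α i)) S :=
  RingHom.pi fun i => f.mapMatrix.comp (Pi.evalRingHom _ i)

theorem tupleMap_apply {R S : Type} [CommRing R] [CommRing S] (f : R →+* S)
    (X : ∀ i, Matrix (Fin (α i)) (Fin (α i)) R) (i : I) : tupleMap α f X i = (X i).map f := rfl

theorem tupleMap_mem_QEnd {M : QRep I E s t α R} {X : ∀ i, Matrix (Fin (α i)) (Fin (α i)) R}
    (hX : X ∈ QEnd k M) :
    tupleMap α (algebraMap R S) X ∈ QEnd K (fun a => (M a).map (algebraMap R S) :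
      QRep I E s t α S) := fun a => by
  simp only [tupleMap_apply]
  rw [← Matrix.map_mul, ← Matrix.map_mul, hX a]

theorem QDecomposable_iff_QEnd [IsLocalRing S] (M : QRep I E s t α S) :
    QDecomposable s t α S M ↔ ∃ e : QEnd K M, IsIdempotentElem e ∧ e ≠ 0 ∧ e ≠ 1 := by
  rw [QDecomposable_iff_exists_isIdempotentElem]
  constructor
  · rintro ⟨e, he, h0, h1, hM⟩
    exact ⟨⟨e, hM⟩, Subtype.ext he, fun h => h0 (congrArg Subtype.val h),
      fun h => h1 (congrArg Subtype.val h)⟩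
  · rintro ⟨e, he, h0, h1⟩
    exact ⟨e, congrArg Subtype.val he, fun h => h0 (Subtype.ext h), fun h => h1 (Subtype.ext h),
      e.2⟩

theorem QEnd_span_range [Finite I] {κ : Type*} (b : Module.Basis κ R S) {c : κ → K}
    (hb : ∀ l, b l = algebraMap K S (c l))
    (M : QRep I E s t α R)
    (j : QEnd k M →+* QEnd K (fun a => (M a).map (algebraMap R S) : QRep I E s t α S))
    (hj : ∀ X, (j X : ∀ i, Matrix (Fin (α i)) (Fin (α i)) S) = tupleMap α (algebraMap R S) X)
    (Y : QEnd K (fun a => (M a).map (algebraMap R S) : QRep I E s t α S)) :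
    Y ∈ Submodule.span K (Set.range j) := by
  classical
  cases nonempty_fintype I
  let X (l : κ) : QEnd k M := ⟨fun i => (Y.1 i).map fun y => b.repr y l, fun a => by
    ext x y
    have h := congrArg (fun z => b.repr z l) (congrFun (congrFun (Y.2 a) x) y)
    simp only [Matrix.mul_apply, map_sum, Finsupp.coe_finsetSum, Finset.sum_apply,
      Matrix.map_apply] at h ⊢
    convert h using 2 with z _ z _
    · rw [mul_comm _ (algebraMap R S _), ← Algebra.smul_def, map_smul, Finsupp.smul_apply,
        smul_eq_mul, mul_comm]
    · rw [← Algebra.smul_def, map_smul, Finsupp.smul_apply, smul_eq_mul]⟩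
  let F : Finset κ := Finset.univ.biUnion fun i : I => Finset.univ.biUnion fun x : Fin (α i) =>
    Finset.univ.biUnion fun y : Fin (α i) => (b.repr (Y.1 i x y)).support
  have hY : Y = ∑ l ∈ F, c l • j (X l) := by
    apply Subtype.ext
    ext i x y
    have h1 := b.linearCombination_repr (Y.1 i x y)
    rw [Finsupp.linearCombination_apply, Finsupp.sum_of_support_subset (s := F)] at h1
    · rw [← h1]
      simp only [AddSubmonoidClass.coe_finsetSum, SetLike.val_smul, hj, Finset.sum_apply,
        Matrix.sum_apply, Pi.smul_apply, Matrix.smul_apply, tupleMap_apply, X, Matrix.map_apply]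
      refine Finset.sum_congr rfl fun l _ => ?_
      rw [hb, Algebra.smul_def, mul_comm, ← Algebra.smul_def]
    · intro l hl
      simp only [F, Finset.mem_biUnion, Finset.mem_univ, true_and]
      exact ⟨i, x, y, hl⟩
    · simp
  rw [hY]
  exact Submodule.sum_mem _ fun l _ => Submodule.smul_mem _ _ (Submodule.subset_span ⟨_, rfl⟩)

variable [Algebra k K]

theorem tupleMap_algebraMap
    (hk : ∀ c, algebraMap R S (algebraMap k R c) = algebraMap K S (algebraMap k K c)) (c : k) :
    tupleMap α (algebraMap R S) (algebraMap k (∀ i, Matrix (Fin (α i)) (Fin (α i)) R) c) =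
      algebraMap K (∀ i, Matrix (Fin (α i)) (Fin (α i)) S) (algebraMap k K c) := by
  ext i x y
  by_cases hxy : x = y <;> simp [tupleMap_apply, algebraMap_matrix_apply, hxy, hk]

variable [Fintype I] [DecidableEq I] [Fintype k] [FiniteDimensional k R]

theorem not_QDecomposable_iff_forall_mulChar_eq_one [IsAlgClosed K] [IsLocalRing S]
    (ρ : R →ₐ[k] k) (hρ : ∀ r, ρ r = 0 → IsNilpotent r) (φ : S →ₐ[K] K)
    (hφρ : ∀ r, φ (algebraMap R S r) = algebraMap k K (ρ r))
    (hk : ∀ c, algebraMap R S (algebraMap k R c) = algebraMap K S (algebraMap k K c))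
    {κ : Type*} (b : Module.Basis κ R S) (c : κ → K) (hb : ∀ l, b l = algebraMap K S (c l))
    {T : Type*} [CommRing T] [IsDomain T] {θ : MulChar k T}
    (hθ : ∑ i, α i ≠ 0 → orderOf θ = ∑ i, α i)
    (M : QRep I E s t α R) :
    ¬ QDecomposable s t α S (fun a => (M a).map (algebraMap R S)) ↔
      ∀ g : QGl I α R, QAct s t α g M = M →
        θ (blockReduction α ρ fun i => (g i).val).det = 1 := by
  have hcard : Fintype.card (Σ i, Fin (α i)) = ∑ i, α i := by simp
  have hdec := QDecomposable_iff_QEnd (K := K) (fun a => (M a).map (algebraMap R S) :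
    QRep I E s t α S)
  let j : QEnd k M →+* QEnd K (fun a => (M a).map (algebraMap R S) : QRep I E s t α S) :=
    ((tupleMap α (algebraMap R S)).comp (QEnd k M).val.toRingHom).codRestrict
      (QEnd K (fun a => (M a).map (algebraMap R S) : QRep I E s t α S))
      fun x => tupleMap_mem_QEnd x.2
  have hj (X) : (j X : ∀ i, Matrix (Fin (α i)) (Fin (α i)) S) =
    tupleMap α (algebraMap R S) X := rfl
  have hjk (c : k) : j (algebraMap k _ c) = algebraMap K _ (algebraMap k K c) :=
    Subtype.ext (tupleMap_algebraMap hk c)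
  constructor
  · intro hM g hg
    let x : QEnd k M := ⟨fun i => (g i).val, (QAct_eq_self_iff M g).1 hg⟩
    have hx : IsAlgebraic K (j x) :=
      ((Algebra.IsIntegral.isIntegral (R := k) x).map_of_comp_eq (algebraMap k K) j
        (RingHom.ext fun c => (hjk c).symm)).isAlgebraic
    obtain ⟨a, ha⟩ := exists_det_eq_pow_card_of_idempotents (k := k) (fun e he => by
        by_contra! h
        exact hM (hdec.2 ⟨e, he, h.1, h.2⟩))
      ((blockReduction α φ).comp (Subalgebra.val _)) hx
      (M := blockReduction α ρ fun i => (g i).val) (by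
        change blockReduction α φ (j x).1 = _
        rw [hj, blockReduction_apply, blockReduction_apply]
        ext ⟨i, y⟩ ⟨l, z⟩
        by_cases hil : i = l
        · subst hil
          simp [tupleMap_apply, hφρ, x]
        · simp [blockDiagonal'_apply, hil])
    rcases Nat.eq_zero_or_pos (∑ i, α i) with h0 | h0
    · rw [ha, hcard, h0, pow_zero, map_one]
    · have hu : IsUnit (blockReduction α ρ fun i => (g i).val) :=
        (MulEquiv.piUnits.symm g).isUnit.map (blockReduction α ρ)
      have hd := (Matrix.isUnit_iff_isUnit_det _).1 hu
      rw [ha, hcard] at hd ⊢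
      have ha' : IsUnit a := (isUnit_pow_iff h0.ne').1 hd
      rw [map_pow, ← MulChar.pow_apply' _ h0.ne', ← hθ h0.ne', pow_orderOf_eq_one,
        MulChar.one_apply ha']
  · intro h hM
    obtain ⟨e, he, h0, h1⟩ := hdec.1 hM
    rcases Nat.eq_zero_or_pos (∑ i, α i) with hα | hα
    · apply h0
      apply Subtype.ext
      ext i x
      have : α i = 0 := by simpa using (Finset.sum_eq_zero_iff.1 hα) i
      exact absurd x.2 (by omega)
    · have key := exists_isNilpotent_sub_of_mulChar_det_eq_one (k := k) (A := QEnd k M)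
        (Φ := (blockReduction α ρ).comp (Subalgebra.val _)) (θ := θ)
        (fun x hx => by
          obtain ⟨n, hn⟩ := isNilpotent_of_isNilpotent_blockReduction ρ hρ x.1 hx
          exact ⟨n, Subtype.ext hn⟩) (by rw [hθ hα.ne', hcard]) (by rwa [hcard])
        (fun x hx => by
          have hu := hx.map (QEnd k M).val
          refine h (MulEquiv.piUnits hu.unit) ((QAct_eq_self_iff M _).2 x.2))
      have := eq_zero_or_one_of_span_range key j hjk (QEnd_span_range b hb M j hj) e he
      tauto

end Characterization

section SplitLocal

open TensorProduct

variable {k R : Type} [Field k] [CommRing R] [Algebra k R]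

theorem exists_algHom_of_bijective_residue [FiniteDimensional k R] [IsLocalRing R]
    (hsplit : Function.Bijective fun c : k => IsLocalRing.residue R (algebraMap k R c)) :
    ∃ ρ : R →ₐ[k] k, ∀ r, ρ r = 0 → IsNilpotent r := by
  have : IsArtinianRing R := IsArtinianRing.of_finite k R
  let f : k ≃ₐ[k] IsLocalRing.ResidueField R :=
    AlgEquiv.ofBijective (Algebra.ofId k (IsLocalRing.ResidueField R)) hsplit
  refine ⟨(f.symm : IsLocalRing.ResidueField R →ₐ[k] k).comp
    (IsScalarTower.toAlgHom k R (IsLocalRing.ResidueField R)), fun r hr => ?_⟩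
  have h1 : IsLocalRing.residue R r = 0 := (map_eq_zero_iff f.symm f.symm.injective).1 hr
  rw [IsLocalRing.residue_eq_zero_iff] at h1
  obtain ⟨n, hn⟩ := (isArtinianRing_iff_isNilpotent_maximalIdeal R).1 this
  exact ⟨n, by simpa [hn] using Ideal.pow_mem_pow h1 n⟩

theorem isNilpotent_of_lift_eq_zero {K : Type} [Field K] [Algebra k K] {ρ : R →ₐ[k] k}
    (hρ : ∀ r, ρ r = 0 → IsNilpotent r) {φ : R ⊗[k] K →+* K}
    (hφ : ∀ r c, φ (r ⊗ₜ c) = algebraMap k K (ρ r) * c) (x : R ⊗[k] K) :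
    IsNilpotent (x - 1 ⊗ₜ φ x) := by
  induction x with
  | zero => simp
  | tmul r c =>
    have h1 : r ⊗ₜ[k] c - 1 ⊗ₜ φ (r ⊗ₜ c) = (r - algebraMap k R (ρ r)) ⊗ₜ[k] c := by
      rw [hφ, sub_tmul, ← Algebra.smul_def, tmul_smul, smul_tmul', Algebra.algebraMap_eq_smul_one]
    obtain ⟨n, hn⟩ := hρ (r - algebraMap k R (ρ r)) (by simp)
    rw [h1]
    exact ⟨n, by rw [Algebra.TensorProduct.tmul_pow, hn, zero_tmul]⟩
  | add x y hx hy =>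
    rw [map_add, tmul_add, add_sub_add_comm]
    exact (Commute.all _ _).isNilpotent_add hx hy

variable {I E : Type} {s t : E → I} {α : I → ℕ} [Fintype I] [DecidableEq I] [Fintype k]
  [FiniteDimensional k R]

theorem QAbsInd_iff_forall_mulChar_eq_one (ρ : R →ₐ[k] k) (hρ : ∀ r, ρ r = 0 → IsNilpotent r)
    {T : Type*} [CommRing T] [IsDomain T] {θ : MulChar k T}
    (hθ : ∑ i, α i ≠ 0 → orderOf θ = ∑ i, α i)
    (M : QRep I E s t α R) :
    QAbsInd k s t α R M ↔ ∀ g : QGl I α R, QAct s t α g M = M →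
      θ (blockReduction α ρ fun i => (g i).val).det = 1 := by
  let : Algebra (AlgebraicClosure k) (R ⊗[k] AlgebraicClosure k) :=
    Algebra.TensorProduct.rightAlgebra
  let φ₀ : R ⊗[k] AlgebraicClosure k →ₐ[k] AlgebraicClosure k :=
    Algebra.TensorProduct.lift ((Algebra.ofId k (AlgebraicClosure k)).comp ρ)
      (AlgHom.id k (AlgebraicClosure k)) fun _ _ => Commute.all _ _
  have hφ₀ (r : R) (c) : φ₀ (r ⊗ₜ c) = algebraMap k _ (ρ r) * c := rfl
  let φ : R ⊗[k] AlgebraicClosure k →ₐ[AlgebraicClosure k] AlgebraicClosure k :=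
    { φ₀.toRingHom with
      commutes' := fun c => by
        change φ₀ (1 ⊗ₜ c) = c
        rw [hφ₀, map_one, map_one, one_mul] }
  have hφ (r : R) (c) : φ (r ⊗ₜ c) = algebraMap k _ (ρ r) * c := rfl
  have hnil := isNilpotent_of_lift_eq_zero hρ (φ := (φ : _ →+* AlgebraicClosure k)) hφ
  have hloc : IsLocalHom (φ : R ⊗[k] AlgebraicClosure k →+* AlgebraicClosure k) := ⟨fun x hx => by
    have h1 : IsUnit (algebraMap (AlgebraicClosure k) (R ⊗[k] AlgebraicClosure k) (φ x)) :=
      hx.map _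
    have h2 := (hnil x).isUnit_add_left_of_commute h1 (Commute.all _ _)
    rwa [show algebraMap (AlgebraicClosure k) (R ⊗[k] AlgebraicClosure k) (φ x) =
      1 ⊗ₜ φ x from rfl, RingHom.coe_coe, add_sub_cancel] at h2⟩
  have : IsLocalRing (R ⊗[k] AlgebraicClosure k) :=
    RingHom.domain_isLocalRing (φ : R ⊗[k] AlgebraicClosure k →+* AlgebraicClosure k)
  exact not_QDecomposable_iff_forall_mulChar_eq_one ρ hρ φ
    (fun r => by
      rw [Algebra.TensorProduct.algebraMap_apply, hφ, mul_one]; rfl)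
    (fun c => by
      rw [Algebra.TensorProduct.algebraMap_apply]
      change (algebraMap k R c) ⊗ₜ[k] 1 = 1 ⊗ₜ (algebraMap k (AlgebraicClosure k) c)
      rw [Algebra.algebraMap_eq_smul_one, Algebra.algebraMap_eq_smul_one, smul_tmul])
    (Algebra.TensorProduct.basis R (Module.Free.chooseBasis k (AlgebraicClosure k)))
    (Module.Free.chooseBasis k (AlgebraicClosure k))
    (fun l => Algebra.TensorProduct.basis_apply _ l) hθ M

end SplitLocal

section TwistedCount

variable {G X : Type} [Group G] [Fintype G] [Fintype X] [MulAction G X]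

open Classical in
theorem card_orbits_mul_card_eq_sum_card_stabilizer (P : X → Prop)
    (hP : ∀ (g : G) x, P x → P (g • x)) :
    Nat.card {O : Set X // ∃ x, P x ∧ O = MulAction.orbit G x} * Fintype.card G =
      ∑ x with P x, Fintype.card (MulAction.stabilizer G x) := by
  have hmem (O : Set X) : O ∈ (Finset.univ.filter P).image (MulAction.orbit G) ↔
      ∃ x, P x ∧ O = MulAction.orbit G x := by
    simp [eq_comm]
  rw [Nat.subtype_card _ hmem, ← Finset.sum_fiberwise_of_maps_to
    (fun x hx => Finset.mem_image_of_mem (MulAction.orbit G) hx), ← smul_eq_mul]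
  refine (Finset.sum_const _).symm.trans (Finset.sum_congr rfl fun O hO => ?_)
  obtain ⟨x, hx, rfl⟩ := (hmem O).1 hO
  have hfilter : ((Finset.univ.filter P).filter fun y => MulAction.orbit G y =
      MulAction.orbit G x) = (MulAction.orbit G x).toFinset := by
    ext y
    simp only [Finset.mem_filter, Finset.mem_univ, true_and, Set.mem_toFinset,
      MulAction.orbit_eq_iff, and_iff_right_iff_imp]
    rintro ⟨g, rfl⟩
    exact hP g x hx
  rw [hfilter]
  have hpos : 0 < Fintype.card (MulAction.orbit G x) :=
    Fintype.card_pos_iff.2 ⟨⟨x, MulAction.mem_orbit_self x⟩⟩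
  apply Nat.eq_of_mul_eq_mul_left hpos
  rw [Finset.mul_sum, Finset.sum_congr rfl (g := fun _ => Fintype.card G), Finset.sum_const,
    Set.toFinset_card, smul_eq_mul]
  intro y hy
  rw [← MulAction.card_orbit_mul_card_stabilizer_eq_card_group G y]
  congr 1
  exact Fintype.card_congr (Equiv.setCongr (MulAction.orbit_eq_iff.2 (Set.mem_toFinset.1 hy)).symm)

open Classical in
theorem card_orbits_mul_card_eq_sum_mul_card_fixedBy {T : Type*} [CommRing T] [IsDomain T]
    (χ : G →* T) :
    (Nat.card {O : Set X // ∃ x, (∀ g : G, g • x = x → χ g = 1) ∧ O = MulAction.orbit G x} : T) *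
      (Fintype.card G : T) = ∑ g, χ g * (Nat.card {x : X // g • x = x} : T) := by
  have h := card_orbits_mul_card_eq_sum_card_stabilizer (G := G) (X := X)
    (fun x => ∀ g : G, g • x = x → χ g = 1) (fun g x hx h hh => by
      have h1 := hx (g⁻¹ * h * g) (by rw [mul_smul, mul_smul, hh, inv_smul_smul])
      rwa [map_mul, map_mul, mul_right_comm, ← map_mul, inv_mul_cancel, map_one, one_mul] at h1)
  rw [← Nat.cast_mul, h, Nat.cast_sum, Finset.sum_filter]
  have h2 (g : G) : χ g * (Nat.card {x : X // g • x = x} : T) =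
      ∑ x : X, if g • x = x then χ g else 0 := by
    rw [Nat.card_eq_fintype_card, Fintype.card_subtype, ← Finset.sum_filter, Finset.sum_const,
      nsmul_eq_mul, mul_comm]
  rw [Finset.sum_congr rfl fun g _ => h2 g, Finset.sum_comm]
  refine Finset.sum_congr rfl fun x _ => ?_
  have h3 : ∑ g : G, (if g • x = x then χ g else 0) =
      ∑ g : MulAction.stabilizer G x, χ.comp (MulAction.stabilizer G x).subtype g := by
    rw [← Finset.sum_filter]
    exact Finset.sum_subtype _ (by simp [MulAction.mem_stabilizer_iff]) _
  rw [h3, sum_hom_units, Nat.cast_ite, Nat.cast_zero]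
  have hiff : (∀ g : G, g • x = x → χ g = 1) ↔
      χ.comp (MulAction.stabilizer G x).subtype = 1 := by
    rw [MonoidHom.ext_iff, Subtype.forall]
    rfl
  by_cases hx : ∀ g : G, g • x = x → χ g = 1
  · rw [if_pos hx, if_pos (hiff.1 hx)]
  · rw [if_neg hx, if_neg (hx ∘ hiff.2)]

end TwistedCount

section Duality

variable {k R : Type} [Field k] [CommRing R] [Algebra k R] [FiniteDimensional k R]
  {m n : Type} [Fintype m] [Fintype n] [DecidableEq m] [DecidableEq n]

theorem Matrix.card_intertwiner_comm (lam : R →ₗ[k] k)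
    (hlam : ∀ J : Ideal R, J ≠ ⊥ → ∃ x ∈ J, lam x ≠ 0) (g : Matrix m m R) (h : Matrix n n R) :
    Nat.card {A : Matrix m n R // g * A = A * h} =
      Nat.card {B : Matrix n m R // h * B = B * g} := by
  let L : Matrix m n R →ₗ[k] Matrix m n R :=
    mulLeftLinearMap n k g - mulRightLinearMap m k h
  let L' : Matrix n m R →ₗ[k] Matrix n m R :=
    mulRightLinearMap n k g - mulLeftLinearMap m k h
  let β : Matrix m n R →ₗ[k] Module.Dual k (Matrix n m R) :=
    LinearMap.mk₂ k (fun A B => lam (A * B).trace)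
      (by simp [Matrix.add_mul]) (by simp) (by simp [Matrix.mul_add]) (by simp)
  have hβ : Function.Injective β := by
    rw [← LinearMap.ker_eq_bot, LinearMap.ker_eq_bot']
    intro A hA
    ext i j
    by_contra hij
    obtain ⟨x, hx, hx0⟩ := hlam (Ideal.span {A i j}) (by simpa using hij)
    obtain ⟨r, rfl⟩ := Ideal.mem_span_singleton'.1 hx
    apply hx0
    have := LinearMap.congr_fun hA (single j i r)
    simpa [β, trace_mul_single, mul_comm] using this
  have hdim : Module.finrank k (Matrix m n R) = Module.finrank k (Matrix n m R) := by
    simp [Module.finrank_matrix, mul_comm]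
  have hβs : Function.Surjective β :=
    (LinearMap.injective_iff_surjective_of_finrank_eq_finrank
      (hdim.trans Subspace.dual_finrank_eq.symm)).1 hβ
  have hadj : β ∘ₗ L = L'.dualMap ∘ₗ β := by
    refine LinearMap.ext fun A => LinearMap.ext fun B => ?_
    change lam ((g * A - A * h) * B).trace = lam (A * (B * g - h * B)).trace
    rw [Matrix.sub_mul, Matrix.mul_sub, trace_sub, trace_sub, Matrix.mul_assoc, trace_mul_comm,
      Matrix.mul_assoc, Matrix.mul_assoc]
  have hrange : Module.finrank k (LinearMap.range L) = Module.finrank k (LinearMap.range L') := by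
    rw [← LinearMap.finrank_range_dualMap_eq_finrank_range L',
      ← LinearMap.range_comp_of_range_eq_top _ (LinearMap.range_eq_top.2 hβs), ← hadj,
      LinearMap.range_comp]
    exact (LinearEquiv.finrank_map_eq (LinearEquiv.ofBijective β ⟨hβ, hβs⟩) _).symm
  have hker : Module.finrank k (LinearMap.ker L) = Module.finrank k (LinearMap.ker L') := by
    have h1 := L.finrank_range_add_finrank_ker
    have h2 := L'.finrank_range_add_finrank_ker
    omega
  have e1 : Nat.card {A : Matrix m n R // g * A = A * h} = Nat.card (LinearMap.ker L) :=
    Nat.card_congr (Equiv.subtypeEquivRight fun A => by simp [L, sub_eq_zero])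
  have e2 : Nat.card {B : Matrix n m R // h * B = B * g} = Nat.card (LinearMap.ker L') :=
    Nat.card_congr (Equiv.subtypeEquivRight fun A => by simp [L', sub_eq_zero, eq_comm])
  rw [e1, e2, Module.natCard_eq_pow_finrank (K := k), hker,
    ← Module.natCard_eq_pow_finrank (K := k)]

end Duality

section Orientation

variable {I E : Type} {α : I → ℕ} {k R : Type} [Field k] [CommRing R] [Algebra k R]

/-- `QAct` as a multiplicative action. -/
abbrev QGl.mulAction (s t : E → I) (α : I → ℕ) (R : Type) [CommRing R] :
    MulAction (QGl I α R) (QRep I E s t α R) where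
  smul := QAct s t α
  one_smul M := by
    change QAct s t α 1 M = M
    rw [QAct_eq_self_iff]
    simp
  mul_smul g h M := by
    change QAct s t α (g * h) M = QAct s t α g (QAct s t α h M)
    ext1 a
    simp [QAct, Matrix.mul_assoc]

theorem card_QAct_eq_self [Fintype E] (s t : E → I) (g : QGl I α R) :
    Nat.card {M : QRep I E s t α R // QAct s t α g M = M} =
      ∏ a, Nat.card {A : Matrix (Fin (α (t a))) (Fin (α (s a))) R //
        (g (t a)).val * A = A * (g (s a)).val} := by
  rw [← Nat.card_pi]
  exact Nat.card_congr ((Equiv.subtypeEquivRight fun M => QAct_eq_self_iff M g).trans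
    (Equiv.subtypePiEquivPi (p := fun a (A : Matrix (Fin (α (t a))) (Fin (α (s a))) R) =>
      (g (t a)).val * A = A * (g (s a)).val)))

/-- The character `g ↦ θ (det (ρ g))` of `G_α(R)`. -/
def detCharacter [Fintype I] [DecidableEq I] {T : Type*} [CommRing T] (α : I → ℕ) (ρ : R →ₐ[k] k)
    (θ : MulChar k T) : QGl I α R →* T where
  toFun g := θ (blockReduction α ρ fun i => (g i).val).det
  map_one' := by
    change θ (blockReduction α ρ 1).det = 1
    simp
  map_mul' g h := by
    change θ (blockReduction α ρ ((fun i => (g i).val) * fun i => (h i).val)).det = _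
    simp

theorem aOrbits_mul_card_eq_sum [Fintype k] [FiniteDimensional k R] [Fintype I] [DecidableEq I]
    [Fintype E] [Fintype (QGl I α R)] (s t : E → I) (ρ : R →ₐ[k] k)
    (hρ : ∀ r, ρ r = 0 → IsNilpotent r) {T : Type*} [CommRing T] [IsDomain T]
    {θ : MulChar k T} (hθ : ∑ i, α i ≠ 0 → orderOf θ = ∑ i, α i) :
    (aOrbits k I E s t α R : T) * (Fintype.card (QGl I α R) : T) =
      ∑ g : QGl I α R, detCharacter α ρ θ g *
        ((∏ a, Nat.card {A : Matrix (Fin (α (t a))) (Fin (α (s a))) R //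
          (g (t a)).val * A = A * (g (s a)).val} : ℕ) : T) := by
  have : Finite R := Module.finite_of_finite k
  have := Fintype.ofFinite (QRep I E s t α R)
  let := QGl.mulAction s t α R
  have h := card_orbits_mul_card_eq_sum_mul_card_fixedBy (X := QRep I E s t α R)
    (detCharacter (R := R) α ρ θ)
  have h1 : aOrbits k I E s t α R = Nat.card {O : Set (QRep I E s t α R) //
      ∃ M, (∀ g : QGl I α R, g • M = M → detCharacter α ρ θ g = 1) ∧
        O = MulAction.orbit (QGl I α R) M} := by
    refine Nat.card_congr (Equiv.subtypeEquivRight fun O => exists_congr fun M =>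
      and_congr (QAbsInd_iff_forall_mulChar_eq_one ρ hρ hθ M) ?_)
    have : {N | ∃ g : QGl I α R, N = QAct s t α g M} = MulAction.orbit (QGl I α R) M :=
      Set.ext fun N => exists_congr fun g => eq_comm
    rw [this]
  rw [h1, h]
  refine Finset.sum_congr rfl fun g _ => ?_
  rw [← card_QAct_eq_self]
  rfl

theorem exists_mulChar_orderOf_of_isPrimitiveRoot [Fintype k] {ζ : k} {n : ℕ} (hn : n ≠ 0)
    (hζ : IsPrimitiveRoot ζ n) : ∃ θ : MulChar k ℂ, orderOf θ = n := by
  refine MulChar.exists_mulChar_orderOf k (hζ.dvd_of_pow_eq_one _ ?_)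
    (Complex.isPrimitiveRoot_exp n hn)
  exact FiniteField.pow_card_sub_one_eq_one ζ (hζ.ne_zero hn)

end Orientation

/-- Over a finite field `k` containing a primitive `|α|`-th root of unity and a split local
Frobenius `k`-algebra `R`, the number of isomorphism classes of absolutely indecomposable
locally free representations of a quiver of rank `α` does not change when the orientation
of some of the arrows is changed. -/
theorem abs_indec_orbits_independent_of_orientation
    (k : Type) [Field k] [Fintype k]
    (R : Type) [CommRing R] [Algebra k R] [FiniteDimensional k R] [IsLocalRing R]
    (hsplit : Function.Bijective fun c : k => IsLocalRing.residue R (algebraMap k R c))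
    (lam : R →ₗ[k] k) (hlam : ∀ J : Ideal R, J ≠ ⊥ → ∃ x ∈ J, lam x ≠ 0)
    (I E : Type) [Fintype I] [Fintype E] (s t s' t' : E → I)
    (hor : ∀ a : E, (s' a = s a ∧ t' a = t a) ∨ (s' a = t a ∧ t' a = s a))
    (α : I → ℕ) (ζ : k) (hζ : IsPrimitiveRoot ζ (∑ i, α i)) :
    aOrbits k I E s t α R = aOrbits k I E s' t' α R := by
  classical
  obtain ⟨ρ, hρ⟩ := exists_algHom_of_bijective_residue hsplit
  have : Finite R := Module.finite_of_finite k
  have := Fintype.ofFinite (QGl I α R)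
  obtain ⟨θ, hθ⟩ : ∃ θ : MulChar k ℂ, ∑ i, α i ≠ 0 → orderOf θ = ∑ i, α i := by
    by_cases hα : ∑ i, α i = 0
    · exact ⟨1, fun h => absurd hα h⟩
    · obtain ⟨θ, hθ⟩ := exists_mulChar_orderOf_of_isPrimitiveRoot hα hζ
      exact ⟨θ, fun _ => hθ⟩
  have h0 : (Fintype.card (QGl I α R) : ℂ) ≠ 0 := Nat.cast_ne_zero.2 Fintype.card_ne_zero
  have h : (aOrbits k I E s t α R : ℂ) = aOrbits k I E s' t' α R := by
    apply mul_right_cancel₀ h0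
    rw [aOrbits_mul_card_eq_sum s t ρ hρ hθ, aOrbits_mul_card_eq_sum s' t' ρ hρ hθ]
    refine Finset.sum_congr rfl fun g _ => ?_
    congr 2
    refine Finset.prod_congr rfl fun a _ => ?_
    rcases hor a with ⟨h1, h2⟩ | ⟨h1, h2⟩
    · rw [h1, h2]
    · rw [h1, h2, card_intertwiner_comm lam hlam]
  exact_mod_cast h
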